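/- arXiv:1905.09675 — 2 statements merged into one kernel-verified Lean document; each statement's English description precedes it below -/
import Mathlib

section
/- Let α ∈ (0,1) and let A be an even 2π-periodic α-Hölder function with A(0) = A(π) = 0. Then for every ε > 0 there exists C(ε) > 0 such that for all even 2π-periodic C^{2+α} functions h with h(0) = h(π) = 0, one has ‖A·h/sin²‖_{C^α} + ‖A·h'/sin‖_{C^α} ≤ ε‖h‖_{C^{2+α}} + C(ε)‖h‖_{C^α}. -/
open Set Filter Topology

noncomputable def supOn (f : ℝ → ℝ) (S : Set ℝ) : ℝ := sSup ((fun x => |f x|) '' S)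

noncomputable def hSemiOn (α : ℝ) (f : ℝ → ℝ) (S : Set ℝ) : ℝ :=
  sSup {r : ℝ | ∃ x ∈ S, ∃ y ∈ S, x ≠ y ∧ r = |f x - f y| / |x - y| ^ α}

noncomputable def hNormOn (k : ℕ) (α : ℝ) (f : ℝ → ℝ) (S : Set ℝ) : ℝ :=
  (∑ j ∈ Finset.range (k + 1), supOn (iteratedDeriv j f) S)
    + hSemiOn α (iteratedDeriv k f) S

lemma supOn_nonneg (f : ℝ → ℝ) (S : Set ℝ) : 0 ≤ supOn f S := by
  apply Real.sSup_nonneg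
  rintro _ ⟨x, -, rfl⟩
  exact abs_nonneg _

lemma hSemiOn_nonneg (α : ℝ) (f : ℝ → ℝ) (S : Set ℝ) : 0 ≤ hSemiOn α f S := by
  apply Real.sSup_nonneg
  rintro _ ⟨x, -, y, -, -, rfl⟩
  positivity

lemma hNormOn_zero_le {α B₀ B₁ : ℝ} {f : ℝ → ℝ} (hB₀ : 0 ≤ B₀) (hB₁ : 0 ≤ B₁)
    (h₀ : ∀ x, |f x| ≤ B₀) (h₁ : ∀ x y, |f x - f y| ≤ B₁ * |x - y| ^ α) :
    hNormOn 0 α f univ ≤ B₀ + B₁ := by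
  simp only [hNormOn, zero_add, Finset.sum_range_one, iteratedDeriv_zero]
  refine add_le_add (Real.sSup_le ?_ hB₀) (Real.sSup_le ?_ hB₁)
  · rintro _ ⟨x, -, rfl⟩
    exact h₀ x
  · rintro _ ⟨x, -, y, -, hxy, rfl⟩
    have : 0 < |x - y| := abs_pos.mpr (sub_ne_zero.mpr hxy)
    rw [div_le_iff₀ (by positivity)]
    exact h₁ x y

lemma abs_sub_le_hSemiOn_mul {α C : ℝ} {f : ℝ → ℝ}
    (hf : ∀ x y, |f x - f y| ≤ C * |x - y| ^ α) (x y : ℝ) :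
    |f x - f y| ≤ hSemiOn α f univ * |x - y| ^ α := by
  rcases eq_or_ne x y with rfl | hxy
  · rw [sub_self, abs_zero]
    exact mul_nonneg (hSemiOn_nonneg _ _ _) (Real.rpow_nonneg (abs_nonneg _) _)
  · have hpos : 0 < |x - y| := abs_pos.mpr (sub_ne_zero.mpr hxy)
    rw [← div_le_iff₀ (by positivity)]
    refine le_csSup ⟨C, ?_⟩ ⟨x, mem_univ _, y, mem_univ _, hxy, rfl⟩
    rintro _ ⟨a, -, b, -, hab, rfl⟩
    have : 0 < |a - b| := abs_pos.mpr (sub_ne_zero.mpr hab)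
    rw [div_le_iff₀ (by positivity)]
    exact hf a b

lemma Function.Periodic.abs_le_supOn {f : ℝ → ℝ} {c : ℝ} (hf : Function.Periodic f c)
    (hc : 0 < c) (hcont : Continuous f) (x : ℝ) : |f x| ≤ supOn f univ := by
  obtain ⟨C, hC⟩ := isCompact_Icc.exists_bound_of_continuousOn (s := Icc 0 c) hcont.continuousOn
  refine le_csSup ⟨C, ?_⟩ ⟨x, mem_univ _, rfl⟩
  rintro _ ⟨y, -, rfl⟩
  obtain ⟨z, hz, hyz⟩ := hf.exists_mem_Ico₀ hc y
  simpa [hyz] using hC z (Ico_subset_Icc_self hz)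

/-- Interpolation: a second derivative is controlled by its Hölder modulus and the sup norm. -/
lemma abs_deriv_deriv_le {h : ℝ → ℝ} {α M N η : ℝ} (hα : 0 ≤ α) (hM : 0 ≤ M) (hη : 0 < η)
    (hh : Differentiable ℝ h) (hh' : Differentiable ℝ (deriv h)) (hN : ∀ x, |h x| ≤ N)
    (hM' : ∀ x y, |deriv (deriv h) x - deriv (deriv h) y| ≤ M * |x - y| ^ α) (x : ℝ) :
    |deriv (deriv h) x| ≤ M * (3 * η) ^ α + 4 * N / η ^ 2 := by
  obtain ⟨a, ha, ha'⟩ := exists_deriv_eq_slope h (show x < x + η by linarith)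
    hh.continuous.continuousOn hh.differentiableOn
  obtain ⟨b, hb, hb'⟩ := exists_deriv_eq_slope h (show x + 2 * η < x + 3 * η by linarith)
    hh.continuous.continuousOn hh.differentiableOn
  obtain ⟨ha1, ha2⟩ := ha
  obtain ⟨hb1, hb2⟩ := hb
  obtain ⟨c, ⟨hc1, hc2⟩, hc'⟩ := exists_deriv_eq_slope (deriv h) (show a < b by linarith)
    hh'.continuous.continuousOn hh'.differentiableOn
  have hslope : |deriv (deriv h) c| ≤ 4 * N / η ^ 2 := by
    have hba : 0 < b - a := by linarith
    have hnum : |deriv h b - deriv h a| ≤ 4 * N / η := by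
      rw [ha', hb', show x + 3 * η - (x + 2 * η) = η by ring, show x + η - x = η by ring,
        ← sub_div, abs_div, abs_of_pos hη]
      gcongr
      have h1 := abs_le.mp (hN x)
      have h2 := abs_le.mp (hN (x + η))
      have h3 := abs_le.mp (hN (x + 2 * η))
      have h4 := abs_le.mp (hN (x + 3 * η))
      exact abs_le.mpr ⟨by linarith, by linarith⟩
    rw [hc', abs_div, abs_of_pos hba]
    calc _ ≤ (4 * N / η) / η := by
          gcongr
          · exact (abs_nonneg _).trans hnum
          · linarith
      _ = _ := by field_simp
  have hclose : |deriv (deriv h) x - deriv (deriv h) c| ≤ M * (3 * η) ^ α := by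
    refine (hM' x c).trans ?_
    gcongr
    exact abs_le.mpr ⟨by linarith, by linarith⟩
  have := abs_add_le (deriv (deriv h) x - deriv (deriv h) c) (deriv (deriv h) c)
  rw [sub_add_cancel] at this
  linarith

lemma exists_abs_sub_int_mul_pi_le (x : ℝ) : ∃ k : ℤ, |x - k * Real.pi| ≤ Real.pi / 2 := by
  refine ⟨round (x / Real.pi), ?_⟩
  have h := abs_sub_round (x / Real.pi)
  have hx : x - round (x / Real.pi) * Real.pi
      = (x / Real.pi - round (x / Real.pi)) * Real.pi := by
    field_simp
  rw [hx, abs_mul, abs_of_pos Real.pi_pos]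
  nlinarith [Real.pi_pos]

lemma abs_le_five_mul_abs_sin {t : ℝ} (ht : |t| ≤ 3 * Real.pi / 4) :
    |t| ≤ 5 * |Real.sin t| := by
  wlog h0 : 0 ≤ t generalizing t
  · simpa using this (t := -t) (by simpa using ht) (by linarith)
  rw [abs_of_nonneg h0] at ht ⊢
  have hpi := Real.pi_pos
  have hpi4 := Real.pi_le_four
  refine le_trans ?_ (mul_le_mul_of_nonneg_left (le_abs_self _) (by norm_num))
  rcases le_total t (Real.pi / 2) with h | h
  · have h1 := Real.mul_le_sin h0 h
    have h2 : 1 / 2 ≤ 2 / Real.pi := by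
      rw [div_le_div_iff₀ (by norm_num) hpi]
      linarith
    nlinarith
  · have h1 := Real.mul_le_sin (x := Real.pi - t) (by linarith) (by linarith)
    rw [Real.sin_pi_sub] at h1
    have h2 : 1 / 2 ≤ 2 / Real.pi * (Real.pi - t) := by
      rw [div_mul_eq_mul_div, div_le_div_iff₀ (by norm_num) hpi]
      linarith
    linarith [Real.pi_lt_d2]

lemma abs_sin_sub_int_mul_pi (x : ℝ) (k : ℤ) : |Real.sin (x - k * Real.pi)| = |Real.sin x| := by
  rw [Real.sin_sub_int_mul_pi, abs_mul]
  simp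

lemma abs_sub_le_five_mul_abs_sin {x : ℝ} {k : ℤ} (h : |x - k * Real.pi| ≤ 3 * Real.pi / 4) :
    |x - k * Real.pi| ≤ 5 * |Real.sin x| := by
  simpa only [abs_sin_sub_int_mul_pi] using abs_le_five_mul_abs_sin h

lemma abs_sin_le_abs_sub_int_mul_pi (x : ℝ) (k : ℤ) : |Real.sin x| ≤ |x - k * Real.pi| := by
  simpa only [abs_sin_sub_int_mul_pi] using Real.abs_sin_le_abs (x := x - k * Real.pi)

lemma abs_sin_sub_sin_le (x y : ℝ) : |Real.sin x - Real.sin y| ≤ |x - y| := by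
  simpa [Real.dist_eq] using Real.lipschitzWith_sin.dist_le_mul x y

lemma abs_sub_le_mul_of_abs_deriv_le {h : ℝ → ℝ} {C r p x y : ℝ} (hh : Differentiable ℝ h)
    (hC : ∀ z, |z - p| ≤ r → |deriv h z| ≤ C) (hx : |x - p| ≤ r) (hy : |y - p| ≤ r) :
    |h x - h y| ≤ C * |x - y| := by
  have hconv := convex_closedBall p r
  refine hconv.norm_image_sub_le_of_norm_deriv_le (fun z _ => hh z) (fun z hz => hC z ?_)
    (by simpa [Real.dist_eq] using hy) (by simpa [Real.dist_eq] using hx)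
  simpa [Real.dist_eq] using hz

lemma abs_sub_le_of_abs_deriv_deriv_le {h : ℝ → ℝ} {N p r x y : ℝ} (hh : Differentiable ℝ h)
    (hh' : Differentiable ℝ (deriv h)) (hN : ∀ z, |deriv (deriv h) z| ≤ N)
    (hp : deriv h p = 0) (hx : |x - p| ≤ r) (hy : |y - p| ≤ r) :
    |h x - h y| ≤ N * r * |x - y| := by
  have hN0 : 0 ≤ N := (abs_nonneg _).trans (hN 0)
  refine abs_sub_le_mul_of_abs_deriv_le hh (fun z hz => ?_) hx hy
  have := abs_sub_le_mul_of_abs_deriv_le (x := z) (y := p) (p := p) hh' (fun w _ => hN w) hz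
    (by simpa using (abs_nonneg _).trans hz)
  rw [hp, sub_zero] at this
  exact this.trans (by gcongr)

/-- If `U` is bounded and has Lipschitz constant of order `1 / dist(x, πℤ)` near each point, and
`A` is `α`-Hölder and vanishes on `πℤ`, then `A * U` is bounded and `α`-Hölder. -/
lemma holder_mul_of_singular {α L K : ℝ} {A U f : ℝ → ℝ} (hα : α ∈ Ioo (0 : ℝ) 1)
    (hL : 0 ≤ L) (hK : 0 ≤ K)
    (hA : ∀ x y, |A x - A y| ≤ L * |x - y| ^ α) (hA0 : ∀ k : ℤ, A (k * Real.pi) = 0)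
    (hU : ∀ x, Real.sin x ≠ 0 → |U x| ≤ K)
    (hU' : ∀ x y, ∀ k : ℤ, Real.sin x ≠ 0 → Real.sin y ≠ 0 → |x - k * Real.pi| ≤ Real.pi / 2 →
      |x - y| ≤ |x - k * Real.pi| / 2 → |U x - U y| ≤ K * |x - y| / |x - k * Real.pi|)
    (hf : Continuous f) (hfU : ∀ x, Real.sin x ≠ 0 → f x = A x * U x) :
    hNormOn 0 α f univ ≤ 7 * L * K := by
  obtain ⟨hα0, hα1⟩ := hα
  have hAk : ∀ (k : ℤ) x, |A x| ≤ L * |x - k * Real.pi| ^ α := fun k x => by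
    simpa [hA0] using hA x (k * Real.pi)
  have hrpow : ∀ c : ℝ, 1 ≤ c → c ^ α ≤ c := fun c hc => by
    simpa using Real.rpow_le_rpow_of_exponent_le hc hα1.le
  have hdense : Dense {x : ℝ | Real.sin x ≠ 0} := by
    have : {x : ℝ | Real.sin x ≠ 0} = (range fun n : ℤ => (n : ℝ) * Real.pi)ᶜ := by
      ext x
      simp [Real.sin_eq_zero_iff]
    rw [this]
    exact (countable_range _).dense_compl ℝ
  have hsup : ∀ x, Real.sin x ≠ 0 → |f x| ≤ 2 * L * K := by
    intro x hx
    obtain ⟨k, hk⟩ := exists_abs_sub_int_mul_pi_le x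
    rw [hfU x hx, abs_mul]
    have h1 : |x - k * Real.pi| ^ α ≤ 2 :=
      (Real.rpow_le_rpow (abs_nonneg _) (hk.trans (by linarith [Real.pi_le_four])) hα0.le).trans
        (hrpow 2 (by norm_num))
    calc |A x| * |U x| ≤ (L * 2) * K := by
          gcongr
          · exact (hAk k x).trans (by gcongr)
          · exact hU x hx
      _ = _ := by ring
  have hhold : ∀ x y, Real.sin x ≠ 0 → Real.sin y ≠ 0 →
      |f x - f y| ≤ 5 * L * K * |x - y| ^ α := by
    intro x y hx hy
    obtain ⟨k, hk⟩ := exists_abs_sub_int_mul_pi_le x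
    rw [hfU x hx, hfU y hy]
    have hR : 0 ≤ |x - y| ^ α := by positivity
    rcases le_total |x - y| (|x - k * Real.pi| / 2) with hxy | hxy
    · have hs : 0 < |x - k * Real.pi| :=
        (abs_pos.mpr hx).trans_le (abs_sin_le_abs_sub_int_mul_pi x k)
      have hratio : |x - k * Real.pi| ^ α * (|x - y| / |x - k * Real.pi|) ≤ |x - y| ^ α := by
        set s := |x - k * Real.pi|
        rcases (abs_nonneg (x - y)).eq_or_lt with h0 | h0
        · simp [← h0, hα0.ne']
        · have h1 : |x - y| ^ (1 - α) ≤ s ^ (1 - α) :=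
            Real.rpow_le_rpow h0.le (by linarith) (by linarith)
          rw [Real.rpow_sub h0, Real.rpow_sub hs, Real.rpow_one, Real.rpow_one,
            div_le_div_iff₀ (by positivity) (by positivity)] at h1
          rw [← mul_div_assoc, div_le_iff₀ hs]
          linarith
      calc |A x * U x - A y * U y| = |A x * (U x - U y) + (A x - A y) * U y| := by ring_nf
        _ ≤ |A x| * |U x - U y| + |A x - A y| * |U y| := by
          rw [← abs_mul, ← abs_mul]
          exact abs_add_le _ _
        _ ≤ (L * |x - k * Real.pi| ^ α) * (K * |x - y| / |x - k * Real.pi|)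
            + (L * |x - y| ^ α) * K := by
          gcongr
          · exact hAk k x
          · exact hU' x y k hx hy hk hxy
          · exact hA x y
          · exact hU y hy
        _ = L * K * (|x - k * Real.pi| ^ α * (|x - y| / |x - k * Real.pi|))
            + L * K * |x - y| ^ α := by ring
        _ ≤ L * K * |x - y| ^ α + L * K * |x - y| ^ α := by gcongr
        _ ≤ 5 * L * K * |x - y| ^ α := by
          have : 0 ≤ L * K * |x - y| ^ α := by positivity
          linarith
    · have hx' : |x - k * Real.pi| ^ α ≤ 2 * |x - y| ^ α := by
        refine (Real.rpow_le_rpow (z := α) (abs_nonneg _)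
          (show _ ≤ 2 * |x - y| by linarith) hα0.le).trans ?_
        rw [Real.mul_rpow (by norm_num) (abs_nonneg _)]
        gcongr
        exact hrpow 2 (by norm_num)
      have hy' : |y - k * Real.pi| ^ α ≤ 3 * |x - y| ^ α := by
        have : |y - k * Real.pi| ≤ 3 * |x - y| := by
          have := abs_sub_le y x (k * Real.pi)
          rw [abs_sub_comm y x] at this
          linarith
        refine (Real.rpow_le_rpow (abs_nonneg _) this hα0.le).trans ?_
        rw [Real.mul_rpow (by norm_num) (abs_nonneg _)]
        gcongr
        exact hrpow 3 (by norm_num)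
      calc |A x * U x - A y * U y| ≤ |A x| * |U x| + |A y| * |U y| := by
            rw [← abs_mul, ← abs_mul]
            exact abs_sub _ _
        _ ≤ (L * (2 * |x - y| ^ α)) * K + (L * (3 * |x - y| ^ α)) * K := by
          gcongr
          · exact (hAk k x).trans (by gcongr)
          · exact hU x hx
          · exact (hAk k y).trans (by gcongr)
          · exact hU y hy
        _ = _ := by ring
  have hsup' : ∀ x, |f x| ≤ 2 * L * K := fun x => by
    have hcl : IsClosed {x | |f x| ≤ 2 * L * K} := isClosed_le hf.abs continuous_const
    exact hcl.closure_subset_iff.mpr hsup (hdense x)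
  have hhold' : ∀ x y, |f x - f y| ≤ 5 * L * K * |x - y| ^ α := fun x y => by
    have hcl : IsClosed {q : ℝ × ℝ | |f q.1 - f q.2| ≤ 5 * L * K * |q.1 - q.2| ^ α} := by
      refine isClosed_le (by fun_prop) (continuous_const.mul ?_)
      exact (continuous_fst.sub continuous_snd).abs.rpow_const fun _ => Or.inr hα0.le
    exact hcl.closure_subset_iff.mpr (fun q hq => hhold q.1 q.2 hq.1 hq.2)
      (hdense.prod hdense (x, y))
  refine (hNormOn_zero_le (by positivity) (by positivity) hsup' hhold').trans (le_of_eq ?_)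
  ring

lemma abs_sub_int_mul_pi_comparable {x y : ℝ} {k : ℤ} (hk : |x - k * Real.pi| ≤ Real.pi / 2)
    (hxy : |x - y| ≤ |x - k * Real.pi| / 2) :
    |y - k * Real.pi| ≤ 3 / 2 * |x - k * Real.pi| ∧
      |x - k * Real.pi| ≤ 5 * |Real.sin x| ∧ |y - k * Real.pi| ≤ 5 * |Real.sin y| := by
  have hy : |y - k * Real.pi| ≤ 3 / 2 * |x - k * Real.pi| := by
    have := abs_sub_le y x (k * Real.pi)
    rw [abs_sub_comm y x] at this
    linarith
  refine ⟨hy, abs_sub_le_five_mul_abs_sin ?_, abs_sub_le_five_mul_abs_sin ?_⟩ <;>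
    linarith [Real.pi_pos]

lemma hNormOn_mul_div_sin_sq_le {α L N : ℝ} {A h f : ℝ → ℝ} (hα : α ∈ Ioo (0 : ℝ) 1)
    (hL : 0 ≤ L) (hA : ∀ x y, |A x - A y| ≤ L * |x - y| ^ α)
    (hA0 : ∀ k : ℤ, A (k * Real.pi) = 0)
    (hh : Differentiable ℝ h) (hh' : Differentiable ℝ (deriv h))
    (hN : ∀ z, |deriv (deriv h) z| ≤ N)
    (h0 : ∀ k : ℤ, h (k * Real.pi) = 0) (h0' : ∀ k : ℤ, deriv h (k * Real.pi) = 0)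
    (hf : Continuous f) (hfU : ∀ x, Real.sin x ≠ 0 → f x = A x * h x / Real.sin x ^ 2) :
    hNormOn 0 α f univ ≤ 7 * L * (2000 * N) := by
  have hN0 : 0 ≤ N := (abs_nonneg _).trans (hN 0)
  have hquad : ∀ (k : ℤ) x, |h x| ≤ N * |x - k * Real.pi| * |x - k * Real.pi| := fun k x => by
    simpa [h0] using abs_sub_le_of_abs_deriv_deriv_le hh hh' hN (h0' k) (x := x)
      (y := k * Real.pi) le_rfl (by simp)
  refine holder_mul_of_singular (U := fun x => h x / Real.sin x ^ 2) hα hL (by positivity) hA hA0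
    ?_ ?_ hf (fun x hx => by rw [hfU x hx, mul_div_assoc])
  · intro x hx
    obtain ⟨k, hk⟩ := exists_abs_sub_int_mul_pi_le x
    have hs := abs_sub_le_five_mul_abs_sin (x := x) (k := k) (by linarith [Real.pi_pos])
    have hx' : 0 < |Real.sin x| := abs_pos.mpr hx
    rw [abs_div, abs_pow, div_le_iff₀ (by positivity)]
    calc |h x| ≤ N * |x - k * Real.pi| * |x - k * Real.pi| := hquad k x
      _ ≤ N * (5 * |Real.sin x|) * (5 * |Real.sin x|) := by gcongr
      _ ≤ 2000 * N * |Real.sin x| ^ 2 := by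
        have : 0 ≤ N * |Real.sin x| ^ 2 := by positivity
        linarith
  · intro x y k hx hy hk hxy
    obtain ⟨hyx, hsx, hsy⟩ := abs_sub_int_mul_pi_comparable hk hxy
    have hdiff := abs_sub_le_of_abs_deriv_deriv_le hh hh' hN (h0' k) (x := x) (y := y)
      (r := 3 / 2 * |x - k * Real.pi|) (by linarith [abs_nonneg (x - k * Real.pi)]) hyx
    have hqy := hquad k y
    have hxs := abs_sin_le_abs_sub_int_mul_pi x k
    have hys := abs_sin_le_abs_sub_int_mul_pi y k
    have hx' : 0 < |Real.sin x| := abs_pos.mpr hx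
    have hy' : 0 < |Real.sin y| := abs_pos.mpr hy
    have hsin := abs_sin_sub_sin_le y x
    rw [abs_sub_comm y x] at hsin
    set s := |x - k * Real.pi|
    set t := |y - k * Real.pi|
    set d := |x - y|
    have hs : 0 < s := hx'.trans_le hxs
    have ht : 0 < t := hy'.trans_le hys
    have hd : 0 ≤ d := abs_nonneg _
    have hsum : |Real.sin y + Real.sin x| ≤ 5 / 2 * s := by
      linarith [abs_add_le (Real.sin y) (Real.sin x)]
    have hinvx : |(Real.sin x ^ 2)⁻¹| ≤ 25 / s ^ 2 := by
      rw [abs_inv, abs_pow, inv_eq_one_div, div_le_div_iff₀ (by positivity) (by positivity)]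
      nlinarith
    have hinvy : |(Real.sin y ^ 2)⁻¹| ≤ 25 / t ^ 2 := by
      rw [abs_inv, abs_pow, inv_eq_one_div, div_le_div_iff₀ (by positivity) (by positivity)]
      nlinarith
    calc |h x / Real.sin x ^ 2 - h y / Real.sin y ^ 2|
        = |(h x - h y) * (Real.sin x ^ 2)⁻¹ + h y * ((Real.sin y - Real.sin x)
            * (Real.sin y + Real.sin x)) * (Real.sin x ^ 2)⁻¹ * (Real.sin y ^ 2)⁻¹| := by
          congr 1
          field_simp
          ring
      _ ≤ |h x - h y| * |(Real.sin x ^ 2)⁻¹| + |h y| * (|Real.sin y - Real.sin x|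
            * |Real.sin y + Real.sin x|) * |(Real.sin x ^ 2)⁻¹| * |(Real.sin y ^ 2)⁻¹| := by
          simp only [← abs_mul]
          exact abs_add_le _ _
      _ ≤ (N * (3 / 2 * s) * d) * (25 / s ^ 2)
          + (N * t * t) * (d * (5 / 2 * s)) * (25 / s ^ 2) * (25 / t ^ 2) := by gcongr
      _ = 1600 * (N * d / s) := by
        field_simp
        ring
      _ ≤ 2000 * N * d / s := by
        have : 0 ≤ N * d / s := by positivity
        rw [mul_assoc, mul_div_assoc 2000]
        linarith

lemma hNormOn_mul_deriv_div_sin_le {α L N : ℝ} {A h g : ℝ → ℝ} (hα : α ∈ Ioo (0 : ℝ) 1)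
    (hL : 0 ≤ L) (hA : ∀ x y, |A x - A y| ≤ L * |x - y| ^ α)
    (hA0 : ∀ k : ℤ, A (k * Real.pi) = 0) (hh' : Differentiable ℝ (deriv h))
    (hN : ∀ z, |deriv (deriv h) z| ≤ N) (h0' : ∀ k : ℤ, deriv h (k * Real.pi) = 0)
    (hg : Continuous g) (hgU : ∀ x, Real.sin x ≠ 0 → g x = A x * deriv h x / Real.sin x) :
    hNormOn 0 α g univ ≤ 7 * L * (30 * N) := by
  have hN0 : 0 ≤ N := (abs_nonneg _).trans (hN 0)
  have hlip : ∀ x y, |deriv h x - deriv h y| ≤ N * |x - y| := fun x y =>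
    abs_sub_le_mul_of_abs_deriv_le (p := x) (r := |y - x|) hh' (fun z _ => hN z) (by simp) le_rfl
  have hlin : ∀ (k : ℤ) x, |deriv h x| ≤ N * |x - k * Real.pi| := fun k x => by
    simpa [h0'] using hlip x (k * Real.pi)
  refine holder_mul_of_singular (U := fun x => deriv h x / Real.sin x) hα hL (by positivity) hA hA0
    ?_ ?_ hg (fun x hx => by rw [hgU x hx, mul_div_assoc])
  · intro x hx
    obtain ⟨k, hk⟩ := exists_abs_sub_int_mul_pi_le x
    have hs := abs_sub_le_five_mul_abs_sin (x := x) (k := k) (by linarith [Real.pi_pos])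
    have hx' : 0 < |Real.sin x| := abs_pos.mpr hx
    rw [abs_div, div_le_iff₀ hx']
    calc |deriv h x| ≤ N * |x - k * Real.pi| := hlin k x
      _ ≤ N * (5 * |Real.sin x|) := by gcongr
      _ ≤ 30 * N * |Real.sin x| := by
        have : 0 ≤ N * |Real.sin x| := by positivity
        linarith
  · intro x y k hx hy hk hxy
    obtain ⟨hyx, hsx, hsy⟩ := abs_sub_int_mul_pi_comparable hk hxy
    have hdiff := hlip x y
    have hly := hlin k y
    have hxs := abs_sin_le_abs_sub_int_mul_pi x k
    have hys := abs_sin_le_abs_sub_int_mul_pi y k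
    have hx' : 0 < |Real.sin x| := abs_pos.mpr hx
    have hy' : 0 < |Real.sin y| := abs_pos.mpr hy
    have hsin := abs_sin_sub_sin_le y x
    rw [abs_sub_comm y x] at hsin
    set s := |x - k * Real.pi|
    set t := |y - k * Real.pi|
    set d := |x - y|
    have hs : 0 < s := hx'.trans_le hxs
    have ht : 0 < t := hy'.trans_le hys
    have hd : 0 ≤ d := abs_nonneg _
    have hinvx : |(Real.sin x)⁻¹| ≤ 5 / s := by
      rw [abs_inv, inv_eq_one_div, div_le_div_iff₀ hx' hs]
      linarith
    have hinvy : |(Real.sin y)⁻¹| ≤ 5 / t := by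
      rw [abs_inv, inv_eq_one_div, div_le_div_iff₀ hy' ht]
      linarith
    calc |deriv h x / Real.sin x - deriv h y / Real.sin y|
        = |(deriv h x - deriv h y) * (Real.sin x)⁻¹
            + deriv h y * (Real.sin y - Real.sin x) * (Real.sin x)⁻¹ * (Real.sin y)⁻¹| := by
          congr 1
          field_simp
          ring
      _ ≤ |deriv h x - deriv h y| * |(Real.sin x)⁻¹|
            + |deriv h y| * |Real.sin y - Real.sin x| * |(Real.sin x)⁻¹| * |(Real.sin y)⁻¹| := by
          simp only [← abs_mul]
          exact abs_add_le _ _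
      _ ≤ (N * d) * (5 / s) + (N * t) * d * (5 / s) * (5 / t) := by gcongr
      _ = 30 * N * d / s := by
        field_simp
        ring

lemma Function.Periodic.eq_zero_int_mul_pi {h : ℝ → ℝ} (hper : Function.Periodic h (2 * Real.pi))
    (h0 : h 0 = 0) (hpi : h Real.pi = 0) (k : ℤ) : h (k * Real.pi) = 0 := by
  rcases Int.even_or_odd' k with ⟨m, rfl | rfl⟩
  · have := hper.int_mul m 0
    rw [h0] at this
    rw [← this]
    push_cast
    ring_nf
  · have := hper.int_mul m Real.pi
    rw [hpi] at this
    rw [← this]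
    push_cast
    ring_nf

lemma Function.Periodic.deriv_int_mul_pi {h : ℝ → ℝ} (hper : Function.Periodic h (2 * Real.pi))
    (heven : ∀ x, h (-x) = h x) (k : ℤ) : deriv h (k * Real.pi) = 0 := by
  have hsymm : (fun x => h (k * (2 * Real.pi) - x)) = h := by
    ext x
    rw [hper.int_mul_sub_eq k, heven]
  have hd := deriv_comp_const_sub (f := h) (k * (2 * Real.pi)) (k * Real.pi)
  rw [hsymm, show (k : ℝ) * (2 * Real.pi) - k * Real.pi = k * Real.pi by ring] at hd
  linarith

/-- Lemma 2.2: for `A` even, `2π`-periodic, `α`-Hölder with `A(0)=A(π)=0` and every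
`ε > 0` there is `C(ε) > 0` such that for all even periodic `C^{2+α}` functions `h`
with `h(0)=h(π)=0`:
`‖A·h/sin²‖_α + ‖A·h'/sin‖_α ≤ ε‖h‖_{C^{2+α}} + C(ε)‖h‖_α`. -/
theorem stmt8 (α : ℝ) (hα : α ∈ Ioo (0:ℝ) 1) (A : ℝ → ℝ)
    (hA_per : Function.Periodic A (2 * Real.pi))
    (hA_even : ∀ x, A (-x) = A x)
    (hA_hold : ∃ C : ℝ, ∀ x y, |A x - A y| ≤ C * |x - y| ^ α)
    (hA0 : A 0 = 0) (hAπ : A Real.pi = 0) :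
    ∀ ε > (0:ℝ), ∃ C > (0:ℝ), ∀ h f g : ℝ → ℝ,
      Function.Periodic h (2 * Real.pi) →
      (∀ x, h (-x) = h x) →
      ContDiff ℝ 2 h →
      (∃ C2 : ℝ, ∀ x y, |iteratedDeriv 2 h x - iteratedDeriv 2 h y| ≤ C2 * |x - y| ^ α) →
      h 0 = 0 → h Real.pi = 0 →
      Continuous f → Continuous g →
      (∀ x, Real.sin x ≠ 0 → f x = A x * h x / Real.sin x ^ 2) →
      (∀ x, Real.sin x ≠ 0 → g x = A x * deriv h x / Real.sin x) →
      hNormOn 0 α f univ + hNormOn 0 α g univ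
        ≤ ε * hNormOn 2 α h univ + C * hNormOn 0 α h univ := by
  obtain ⟨hα0, hα1⟩ := id hα
  obtain ⟨L, hL⟩ := hA_hold
  have hA : ∀ x y, |A x - A y| ≤ |L| * |x - y| ^ α := fun x y =>
    (hL x y).trans (by gcongr; exact le_abs_self L)
  have hA_zero := hA_per.eq_zero_int_mul_pi hA0 hAπ
  intro ε hε
  set K : ℝ := 7 * |L| * 2030 + 1 with hK
  have hKpos : 0 < K := by positivity
  set η : ℝ := (ε / K) ^ (1 / α) / 3 with hη
  have hηpos : 0 < η := by positivity
  have hηα : (3 * η) ^ α = ε / K := by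
    rw [hη, mul_div_cancel₀ _ (by norm_num), ← Real.rpow_mul (by positivity),
      one_div_mul_cancel hα0.ne', Real.rpow_one]
  refine ⟨K * (4 / η ^ 2), by positivity, ?_⟩
  intro h f g hper heven hC2 ⟨C2, hC2'⟩ h0 hπ hf hg hfU hgU
  have hh : Differentiable ℝ h := hC2.differentiable (by norm_num)
  have hh' : Differentiable ℝ (deriv h) := by
    have : ContDiff ℝ 1 (deriv h) := (contDiff_succ_iff_deriv (n := 1)).mp hC2 |>.2.2
    exact this.differentiable (by norm_num)
  have hiter : iteratedDeriv 2 h = deriv (deriv h) := by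
    rw [iteratedDeriv_succ, iteratedDeriv_one]
  set M := hSemiOn α (iteratedDeriv 2 h) univ with hM
  have hM0 : 0 ≤ M := hSemiOn_nonneg _ _ _
  have hMbound := abs_sub_le_hSemiOn_mul hC2'
  rw [← hM, hiter] at hMbound
  have hN := abs_deriv_deriv_le hα0.le hM0 hηpos hh hh'
    (hper.abs_le_supOn Real.two_pi_pos hC2.continuous) hMbound
  rw [hηα] at hN
  set N := M * (ε / K) + 4 * supOn h univ / η ^ 2 with hN_def
  have hsup0 : 0 ≤ supOn h univ := supOn_nonneg _ _
  have hN0 : 0 ≤ N := by positivity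
  have hd0 := hper.deriv_int_mul_pi heven
  have hf_le := hNormOn_mul_div_sin_sq_le hα (abs_nonneg L) hA hA_zero hh hh' hN
    (hper.eq_zero_int_mul_pi h0 hπ) hd0 hf hfU
  have hg_le := hNormOn_mul_deriv_div_sin_le hα (abs_nonneg L) hA hA_zero hh' hN hd0 hg hgU
  have hM_le : M ≤ hNormOn 2 α h univ := by
    have : 0 ≤ ∑ j ∈ Finset.range (2 + 1), supOn (iteratedDeriv j h) univ :=
      Finset.sum_nonneg fun j _ => supOn_nonneg _ _
    rw [hNormOn]
    linarith
  have hsup_le : supOn h univ ≤ hNormOn 0 α h univ := by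
    simpa [hNormOn] using hSemiOn_nonneg α h univ
  calc hNormOn 0 α f univ + hNormOn 0 α g univ ≤ K * N := by
        rw [hK]
        linarith
    _ = ε * M + K * (4 / η ^ 2) * supOn h univ := by
      rw [hN_def]
      field_simp
    _ ≤ _ := by gcongr
end

section
/- Let α ∈ (0,1), k ∈ {0,2}. For an even function h : ℝ → ℝ of class C^{k+α}, define the radially symmetric function u : ℝ² → ℝ by u(z) = h(|z|). Then ‖h‖_{C^α(ℝ)} = ‖u‖_{C^α(ℝ²)}, and if h ∈ C^{2+α} then u ∈ C^{2+α}(ℝ²) with ‖h‖_{C^{2+α}(ℝ)} ≤ ‖u‖_{C^{2+α}(ℝ²)} ≤ C‖h‖_{C^{2+α}(ℝ)} for a constant C ≥ 1 independent of h. -/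
open Set Filter Topology

/-- The `C^α` norm of a function on the plane. -/
noncomputable def c0NormE (α : ℝ) (u : EuclideanSpace ℝ (Fin 2) → ℝ) : ℝ :=
  sSup (Set.range fun z => |u z|) +
    sSup {r : ℝ | ∃ z w : EuclideanSpace ℝ (Fin 2), z ≠ w ∧ r = |u z - u w| / ‖z - w‖ ^ α}

/-- The `C^{2+α}` norm of a function on the plane. -/
noncomputable def c2NormE (α : ℝ) (u : EuclideanSpace ℝ (Fin 2) → ℝ) : ℝ :=
  (∑ j ∈ Finset.range 3, sSup (Set.range fun z => ‖iteratedFDeriv ℝ j u z‖)) +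
    sSup {r : ℝ | ∃ z w : EuclideanSpace ℝ (Fin 2), z ≠ w ∧
      r = ‖iteratedFDeriv ℝ 2 u z - iteratedFDeriv ℝ 2 u w‖ / ‖z - w‖ ^ α}

/-- The average of `g` over the segment from `0` to `r`. -/
noncomputable def originAverage (g : ℝ → ℝ) (r : ℝ) : ℝ := ∫ t in (0:ℝ)..1, g (t * r)

lemma originAverage_zero (g : ℝ → ℝ) : originAverage g 0 = g 0 := by
  simp [originAverage]

lemma intervalIntegrable_comp_mul {g : ℝ → ℝ} (hg : Continuous g) (r a b : ℝ) :
    IntervalIntegrable (fun t => g (t * r)) MeasureTheory.volume a b :=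
  (hg.comp (continuous_id.mul continuous_const)).intervalIntegrable a b

lemma abs_originAverage_le {g : ℝ → ℝ} {S : ℝ} (hS : ∀ x, |g x| ≤ S) (r : ℝ) :
    |originAverage g r| ≤ S := by
  simpa [originAverage] using intervalIntegral.norm_integral_le_of_norm_le_const
    (a := (0:ℝ)) (b := 1) (f := fun t => g (t * r)) (fun x _ => hS (x * r))

lemma abs_originAverage_sub_le {g : ℝ → ℝ} {α H : ℝ} (hg : Continuous g) (hα : 0 ≤ α)
    (hH : ∀ x y, |g x - g y| ≤ H * |x - y| ^ α) (r s : ℝ) :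
    |originAverage g r - originAverage g s| ≤ H * |r - s| ^ α := by
  have hH0 : 0 ≤ H := by simpa using (abs_nonneg _).trans (hH 1 0)
  rw [originAverage, originAverage, ← intervalIntegral.integral_sub
    (intervalIntegrable_comp_mul hg r 0 1) (intervalIntegrable_comp_mul hg s 0 1)]
  have := intervalIntegral.norm_integral_le_of_norm_le_const
    (a := (0:ℝ)) (b := 1) (f := fun t => g (t * r) - g (t * s)) (C := H * |r - s| ^ α) ?_
  · simpa using this
  intro t ht
  rw [uIoc_of_le zero_le_one] at ht
  refine (hH _ _).trans ?_
  rw [← mul_sub, abs_mul, abs_of_pos ht.1]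
  have := ht.1.le
  gcongr
  exact mul_le_of_le_one_left (abs_nonneg _) ht.2

lemma originAverage_mul_self {f g : ℝ → ℝ} (hg : Continuous g) (hf : ∀ x, HasDerivAt f (g x) x)
    (h0 : f 0 = 0) (r : ℝ) : originAverage g r * r = f r := by
  rw [mul_comm, originAverage, intervalIntegral.mul_integral_comp_mul_right, zero_mul, one_mul,
    intervalIntegral.integral_eq_sub_of_hasDerivAt (fun x _ => hf x) (hg.intervalIntegrable 0 r),
    h0, sub_zero]

lemma hasDerivAt_originAverage {f g : ℝ → ℝ} (hg : Continuous g)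
    (hf : ∀ x, HasDerivAt f (g x) x) (h0 : f 0 = 0) {r : ℝ} (hr : r ≠ 0) :
    HasDerivAt (originAverage g) ((g r - originAverage g r) / r) r := by
  have key : HasDerivAt (fun x => f x / x) ((g r * r - f r * 1) / r ^ 2) r :=
    (hf r).div (hasDerivAt_id r) hr
  have heq : originAverage g =ᶠ[𝓝 r] fun x => f x / x := by
    filter_upwards [isOpen_ne.mem_nhds hr] with x hx
    rw [← originAverage_mul_self hg hf h0 x, mul_div_cancel_right₀ _ hx]
  refine (key.congr_of_eventuallyEq heq).congr_deriv ?_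
  rw [← originAverage_mul_self hg hf h0 r]
  field_simp

section InnerProductSpace

set_option maxSynthPendingDepth 3

variable {E : Type*} [NormedAddCommGroup E] [InnerProductSpace ℝ E]

lemma hasFDerivAt_norm_of_ne_zero {z : E} (hz : z ≠ 0) :
    HasFDerivAt (fun z : E => ‖z‖) (‖z‖⁻¹ • innerSL ℝ z) z := by
  have h := ((hasStrictFDerivAt_norm_sq z).hasFDerivAt).sqrt
    (pow_ne_zero 2 (norm_ne_zero_iff.2 hz))
  simp only [Real.sqrt_sq (norm_nonneg _)] at h
  refine h.congr_fderiv ?_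
  ext v
  simp
  field_simp

/-- The gradient of the radial function `h ‖z‖`, where `f = h'` and `g = h''`. -/
lemma hasFDerivAt_comp_norm {h f g : ℝ → ℝ} (hh : ∀ x, HasDerivAt h (f x) x)
    (hg : Continuous g) (hf : ∀ x, HasDerivAt f (g x) x) (h0 : f 0 = 0) (z : E) :
    HasFDerivAt (fun z : E => h ‖z‖) (originAverage g ‖z‖ • innerSL ℝ z) z := by
  rcases eq_or_ne z 0 with rfl | hz
  · have hd := hh 0
    rw [h0, hasDerivAt_iff_isLittleO_nhds_zero] at hd
    rw [hasFDerivAt_iff_isLittleO_nhds_zero]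
    have hd' := (hd.comp_tendsto (tendsto_norm_zero (E := E))).norm_right
    refine Asymptotics.IsLittleO.congr' hd' ?_ ?_ |>.of_norm_right
    · exact Eventually.of_forall fun v => by simp
    · exact Eventually.of_forall fun v => by simp
  · refine ((hh ‖z‖).comp_hasFDerivAt z (hasFDerivAt_norm_of_ne_zero hz)).congr_fderiv ?_
    rw [← originAverage_mul_self hg hf h0, smul_smul,
      mul_inv_cancel_right₀ (norm_ne_zero_iff.2 hz)]

variable (E) in
/-- The inner product as a bilinear map. -/
noncomputable def innerBilin : E →L[ℝ] E →L[ℝ] ℝ := innerSL ℝ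

lemma innerBilin_apply (z : E) : innerBilin E z = innerSL ℝ z := rfl

lemma norm_innerBilin_le_one : ‖innerBilin E‖ ≤ 1 := norm_innerSL_le ℝ

/-- The tensor square `n ⊗ n` of the direction `n = z / ‖z‖`. -/
noncomputable def directionSq (z : E) : E →L[ℝ] E →L[ℝ] ℝ :=
  (innerSL ℝ (‖z‖⁻¹ • z)).smulRight (innerSL ℝ (‖z‖⁻¹ • z))

/-- The Hessian of the radial function with second radial derivative `g`. -/
noncomputable def radialHessian (g : ℝ → ℝ) (z : E) : E →L[ℝ] E →L[ℝ] ℝ :=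
  originAverage g ‖z‖ • innerBilin E + (g ‖z‖ - originAverage g ‖z‖) • directionSq z

lemma hasFDerivAt_radialGradient {f g : ℝ → ℝ} (hg : Continuous g)
    (hf : ∀ x, HasDerivAt f (g x) x) (h0 : f 0 = 0) (hc : Continuous (originAverage g)) (z : E) :
    HasFDerivAt (fun z : E => originAverage g ‖z‖ • innerSL ℝ z) (radialHessian g z) z := by
  rcases eq_or_ne z 0 with rfl | hz
  · rw [hasFDerivAt_iff_isLittleO_nhds_zero]
    have h1 : (fun v : E => originAverage g ‖v‖ - g 0) =o[𝓝 0] (fun _ => (1:ℝ)) := by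
      rw [Asymptotics.isLittleO_one_iff]
      have : Tendsto (fun v : E => originAverage g ‖v‖ - g 0) (𝓝 0)
          (𝓝 (originAverage g ‖(0:E)‖ - g 0)) :=
        ((hc.comp continuous_norm).sub continuous_const).tendsto 0
      simpa [originAverage_zero] using this
    have h2 : (fun v : E => innerSL ℝ v) =O[𝓝 0] (fun v : E => v) :=
      (innerSL ℝ).isBigO_id _
    have h3 := (h1.smul_isBigO h2).norm_right
    refine Asymptotics.IsLittleO.congr' h3 ?_ ?_ |>.of_norm_right
    · exact Eventually.of_forall fun v => by
        simp [radialHessian, originAverage_zero, sub_smul, innerBilin_apply]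
    · exact Eventually.of_forall fun v => by simp
  · have hz' := norm_ne_zero_iff.2 hz
    have h1 := (hasDerivAt_originAverage hg hf h0 hz').comp_hasFDerivAt z
      (hasFDerivAt_norm_of_ne_zero hz)
    have h2 := h1.smul ((innerBilin E).hasFDerivAt (x := z))
    refine h2.congr_fderiv ?_
    ext v w
    simp [radialHessian, directionSq, innerBilin_apply]
    field_simp

lemma norm_normalize_le_one (z : E) : ‖‖z‖⁻¹ • z‖ ≤ 1 := by
  rw [norm_smul, norm_inv, norm_norm]
  exact inv_mul_le_one

lemma norm_directionSq_le_one (z : E) : ‖directionSq z‖ ≤ 1 := by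
  rw [directionSq, ContinuousLinearMap.norm_smulRight_apply, innerSL_apply_norm]
  exact mul_le_one₀ (norm_normalize_le_one z) (norm_nonneg _) (norm_normalize_le_one z)

lemma norm_mul_norm_normalize_sub_le {z w : E} (hw : ‖w‖ ≤ ‖z‖) :
    ‖z‖ * ‖‖z‖⁻¹ • z - ‖w‖⁻¹ • w‖ ≤ 2 * ‖z - w‖ := by
  rcases eq_or_ne z 0 with rfl | hz
  · simp
  rcases eq_or_ne w 0 with rfl | hw0
  · have := mul_le_of_le_one_right (norm_nonneg z) (norm_normalize_le_one z)
    simp only [smul_zero, sub_zero]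
    linarith [norm_nonneg z]
  have hz' := norm_ne_zero_iff.2 hz
  have hw' := norm_ne_zero_iff.2 hw0
  have e : ‖z‖ • (‖z‖⁻¹ • z - ‖w‖⁻¹ • w) = (z - w) - (‖z‖ - ‖w‖) • ‖w‖⁻¹ • w := by
    rw [smul_sub, smul_inv_smul₀ hz', sub_smul, smul_inv_smul₀ hw']
    abel
  calc ‖z‖ * ‖‖z‖⁻¹ • z - ‖w‖⁻¹ • w‖
      = ‖(z - w) - (‖z‖ - ‖w‖) • ‖w‖⁻¹ • w‖ := by rw [← e, norm_smul, norm_norm]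
    _ ≤ ‖z - w‖ + |‖z‖ - ‖w‖| * ‖‖w‖⁻¹ • w‖ := by
        refine (norm_sub_le _ _).trans_eq ?_
        rw [norm_smul, Real.norm_eq_abs]
    _ ≤ ‖z - w‖ + ‖z - w‖ * 1 := by
        gcongr
        · exact abs_norm_sub_norm_le z w
        · exact norm_normalize_le_one w
    _ = 2 * ‖z - w‖ := by ring

lemma norm_directionSq_sub_le (z w : E) :
    ‖directionSq z - directionSq w‖ ≤ 2 * ‖‖z‖⁻¹ • z - ‖w‖⁻¹ • w‖ := by
  have hz := norm_normalize_le_one z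
  have hw := norm_normalize_le_one w
  unfold directionSq
  generalize ‖z‖⁻¹ • z = n at *
  generalize ‖w‖⁻¹ • w = m at *
  have e : (innerSL ℝ n).smulRight (innerSL ℝ n) - (innerSL ℝ m).smulRight (innerSL ℝ m)
      = (innerSL ℝ (n - m)).smulRight (innerSL ℝ n)
        + (innerSL ℝ m).smulRight (innerSL ℝ (n - m)) := by
    ext v u
    simp
    ring
  rw [e]
  refine (norm_add_le _ _).trans ?_
  simp only [ContinuousLinearMap.norm_smulRight_apply, innerSL_apply_norm]
  nlinarith [norm_nonneg (n - m)]

lemma norm_rpow_mul_norm_directionSq_sub_le {α : ℝ} (h0 : 0 ≤ α) (h1 : α ≤ 1) {z w : E}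
    (hw : ‖w‖ ≤ ‖z‖) :
    ‖z‖ ^ α * ‖directionSq z - directionSq w‖ ≤ 4 * ‖z - w‖ ^ α := by
  rcases le_total ‖z‖ ‖z - w‖ with hle | hle
  · have h2 : ‖directionSq z - directionSq w‖ ≤ 4 := by
      linarith [norm_sub_le (directionSq z) (directionSq w), norm_directionSq_le_one z,
        norm_directionSq_le_one w]
    rw [mul_comm 4]
    gcongr
  · rcases (norm_nonneg z).eq_or_lt with hz | hz
    · rw [norm_eq_zero.1 hz.symm] at hw ⊢
      simp only [norm_zero, norm_le_zero_iff] at hw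
      simp only [hw, sub_self, norm_zero (E := E →L[ℝ] E →L[ℝ] ℝ), mul_zero]
      positivity
    have hq : ‖z - w‖ / ‖z‖ ≤ (‖z - w‖ / ‖z‖) ^ α :=
      Real.self_le_rpow_of_le_one (by positivity) ((div_le_one hz).2 hle) h1
    rw [Real.div_rpow (norm_nonneg _) (norm_nonneg _)] at hq
    have hd : ‖directionSq z - directionSq w‖ ≤ 4 * (‖z - w‖ / ‖z‖) := by
      refine (norm_directionSq_sub_le z w).trans ?_
      have := norm_mul_norm_normalize_sub_le hw
      rw [← mul_div_assoc, le_div_iff₀ hz]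
      linarith
    calc ‖z‖ ^ α * ‖directionSq z - directionSq w‖
        ≤ ‖z‖ ^ α * (4 * (‖z - w‖ ^ α / ‖z‖ ^ α)) := by
          gcongr
          linarith
      _ = 4 * ‖z - w‖ ^ α := by
          have := (Real.rpow_pos_of_pos hz α).ne'
          field_simp

lemma norm_radialHessian_le {g : ℝ → ℝ} {S : ℝ} (hS : ∀ x, |g x| ≤ S) (z : E) :
    ‖radialHessian g z‖ ≤ 3 * S := by
  have h1 := abs_originAverage_le hS ‖z‖
  have h2 : |g ‖z‖ - originAverage g ‖z‖| ≤ S + S :=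
    (abs_sub _ _).trans (add_le_add (hS _) h1)
  have hS0 : 0 ≤ S := (abs_nonneg _).trans h1
  refine (norm_add_le _ _).trans ?_
  rw [norm_smul, norm_smul, Real.norm_eq_abs, Real.norm_eq_abs]
  calc _ ≤ S * 1 + (S + S) * 1 := by
        gcongr
        · exact norm_innerBilin_le_one
        · exact norm_directionSq_le_one z
    _ = 3 * S := by ring

lemma norm_radialHessian_sub_le {g : ℝ → ℝ} {α H : ℝ} (hg : Continuous g) (h0 : 0 < α)
    (h1 : α ≤ 1) (hH : ∀ x y, |g x - g y| ≤ H * |x - y| ^ α) (z w : E) :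
    ‖radialHessian g z - radialHessian g w‖ ≤ 11 * H * ‖z - w‖ ^ α := by
  wlog hw : ‖w‖ ≤ ‖z‖ generalizing z w
  · rw [norm_sub_rev (radialHessian g z), norm_sub_rev z w]
    exact this w z (le_of_not_ge hw)
  have hH0 : 0 ≤ H := by simpa using (abs_nonneg _).trans (hH 1 0)
  have hav := abs_originAverage_sub_le hg h0.le hH
  have hψ : ∀ r s, |(g r - originAverage g r) - (g s - originAverage g s)|
      ≤ 2 * H * |r - s| ^ α := fun r s => by
    rw [sub_sub_sub_comm]
    linarith [abs_sub (g r - g s) (originAverage g r - originAverage g s), hav r s, hH r s]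
  have hψz : |g ‖z‖ - originAverage g ‖z‖| ≤ 2 * H * ‖z‖ ^ α := by
    simpa [originAverage_zero] using hψ ‖z‖ 0
  have hzw : |‖z‖ - ‖w‖| ^ α ≤ ‖z - w‖ ^ α := by
    gcongr
    exact abs_norm_sub_norm_le z w
  have e : radialHessian g z - radialHessian g w
      = (originAverage g ‖z‖ - originAverage g ‖w‖) • innerBilin E
        + ((g ‖z‖ - originAverage g ‖z‖) - (g ‖w‖ - originAverage g ‖w‖)) • directionSq w
        + (g ‖z‖ - originAverage g ‖z‖) • (directionSq z - directionSq w) := by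
    unfold radialHessian
    module
  rw [e]
  refine norm_add₃_le.trans ?_
  simp only [norm_smul, Real.norm_eq_abs]
  calc _ ≤ H * ‖z - w‖ ^ α * 1 + 2 * H * ‖z - w‖ ^ α * 1
        + 2 * H * ‖z‖ ^ α * ‖directionSq z - directionSq w‖ := by
        gcongr
        · exact (hav _ _).trans (by gcongr)
        · exact norm_innerBilin_le_one
        · exact (hψ _ _).trans (by gcongr)
        · exact norm_directionSq_le_one w
    _ ≤ H * ‖z - w‖ ^ α * 1 + 2 * H * ‖z - w‖ ^ α * 1 + 2 * H * (4 * ‖z - w‖ ^ α) := by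
        rw [mul_assoc (2 * H) (‖z‖ ^ α)]
        gcongr _ + 2 * H * ?_
        exact norm_rpow_mul_norm_directionSq_sub_le h0.le h1 hw
    _ = 11 * H * ‖z - w‖ ^ α := by ring

lemma continuous_of_norm_sub_le_rpow {X F : Type*} [SeminormedAddCommGroup X]
    [SeminormedAddCommGroup F] {A : X → F} {α K : ℝ} (h0 : 0 < α)
    (hA : ∀ z w, ‖A z - A w‖ ≤ K * ‖z - w‖ ^ α) : Continuous A := by
  rw [continuous_iff_continuousAt]
  intro w
  rw [ContinuousAt, tendsto_iff_norm_sub_tendsto_zero]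
  have hc : Continuous fun z : X => K * ‖z - w‖ ^ α :=
    continuous_const.mul ((continuous_id.sub continuous_const).norm.rpow_const
      fun _ => Or.inr h0.le)
  have := hc.tendsto w
  simp only [sub_self, norm_zero, Real.zero_rpow h0.ne', mul_zero] at this
  exact squeeze_zero (fun _ => norm_nonneg _) (fun z => hA z w) this

section Radial

variable {h f g : ℝ → ℝ} (hh : ∀ x, HasDerivAt h (f x) x) (hf : ∀ x, HasDerivAt f (g x) x)
  (hg : Continuous g) (h0 : f 0 = 0)

include hh hf hg h0

lemma fderiv_comp_norm :
    fderiv ℝ (fun z : E => h ‖z‖) = fun z => originAverage g ‖z‖ • innerSL ℝ z :=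
  funext fun z => (hasFDerivAt_comp_norm hh hg hf h0 z).fderiv

lemma norm_iteratedFDeriv_one_comp_norm (z : E) :
    ‖iteratedFDeriv ℝ 1 (fun z : E => h ‖z‖) z‖ = |f ‖z‖| := by
  rw [norm_iteratedFDeriv_one, fderiv_comp_norm hh hf hg h0, norm_smul, innerSL_apply_norm,
    ← originAverage_mul_self hg hf h0, abs_mul, abs_norm, Real.norm_eq_abs]

variable (hc : Continuous (originAverage g))

include hc

lemma fderiv_fderiv_comp_norm :
    fderiv ℝ (fderiv ℝ fun z : E => h ‖z‖) = radialHessian g := by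
  rw [fderiv_comp_norm hh hf hg h0]
  exact funext fun z => (hasFDerivAt_radialGradient hg hf h0 hc z).fderiv

lemma contDiff_two_comp_norm (hH : Continuous (radialHessian g : E → E →L[ℝ] E →L[ℝ] ℝ)) :
    ContDiff ℝ 2 fun z : E => h ‖z‖ := by
  rw [show (2 : WithTop ℕ∞) = 1 + 1 from one_add_one_eq_two.symm, contDiff_succ_iff_fderiv,
    contDiff_one_iff_fderiv, fderiv_fderiv_comp_norm hh hf hg h0 hc, fderiv_comp_norm hh hf hg h0]
  exact ⟨fun z => (hasFDerivAt_comp_norm hh hg hf h0 z).differentiableAt, by simp,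
    fun z => (hasFDerivAt_radialGradient hg hf h0 hc z).differentiableAt, hH⟩

lemma norm_iteratedFDeriv_two_comp_norm_le (z : E) :
    ‖iteratedFDeriv ℝ 2 (fun z : E => h ‖z‖) z‖ ≤ ‖radialHessian g z‖ := by
  refine ContinuousMultilinearMap.opNorm_le_bound (norm_nonneg _) fun m => ?_
  rw [iteratedFDeriv_two_apply, fderiv_fderiv_comp_norm hh hf hg h0 hc, Fin.prod_univ_two,
    ← mul_assoc]
  exact (radialHessian g z).le_opNorm₂ _ _

lemma norm_iteratedFDeriv_two_comp_norm_sub_le (z w : E) :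
    ‖iteratedFDeriv ℝ 2 (fun z : E => h ‖z‖) z - iteratedFDeriv ℝ 2 (fun z : E => h ‖z‖) w‖
      ≤ ‖radialHessian g z - radialHessian g w‖ := by
  refine ContinuousMultilinearMap.opNorm_le_bound (norm_nonneg _) fun m => ?_
  rw [sub_apply, iteratedFDeriv_two_apply, iteratedFDeriv_two_apply,
    fderiv_fderiv_comp_norm hh hf hg h0 hc, Fin.prod_univ_two, ← mul_assoc]
  exact (radialHessian g z - radialHessian g w).le_opNorm₂ _ _

end Radial

section UnitVector

variable {h : ℝ → ℝ} (heven : ∀ x, h (-x) = h x) {e : E} (he : ‖e‖ = 1)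

include heven he

lemma even_comp_norm_smul (x : ℝ) : h ‖x • e‖ = h x := by
  rw [norm_smul, he, mul_one, Real.norm_eq_abs]
  rcases abs_choice x with hx | hx <;> simp only [hx, heven]

lemma iteratedDeriv_eq_iteratedFDeriv_comp_norm {n j : ℕ} (hj : j ≤ n)
    (hu : ContDiff ℝ n fun z : E => h ‖z‖) (x : ℝ) :
    iteratedDeriv j h x = iteratedFDeriv ℝ j (fun z : E => h ‖z‖) (x • e) fun _ => e := by
  have hcomp : h = (fun z : E => h ‖z‖) ∘ ContinuousLinearMap.toSpanSingleton ℝ e :=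
    funext fun x => (even_comp_norm_smul heven he x).symm
  rw [iteratedDeriv_eq_iteratedFDeriv]
  conv_lhs => rw [hcomp]
  rw [ContinuousLinearMap.iteratedFDeriv_comp_right _ hu _ (by exact_mod_cast hj)]
  simp

lemma abs_iteratedDeriv_le_norm_iteratedFDeriv {n j : ℕ} (hj : j ≤ n)
    (hu : ContDiff ℝ n fun z : E => h ‖z‖) (x : ℝ) :
    |iteratedDeriv j h x| ≤ ‖iteratedFDeriv ℝ j (fun z : E => h ‖z‖) (x • e)‖ := by
  rw [iteratedDeriv_eq_iteratedFDeriv_comp_norm heven he hj hu]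
  simpa [he] using (iteratedFDeriv ℝ j (fun z : E => h ‖z‖) (x • e)).le_opNorm fun _ => e

lemma abs_iteratedDeriv_sub_le_norm_iteratedFDeriv_sub {n j : ℕ} (hj : j ≤ n)
    (hu : ContDiff ℝ n fun z : E => h ‖z‖) (x y : ℝ) :
    |iteratedDeriv j h x - iteratedDeriv j h y| ≤
      ‖iteratedFDeriv ℝ j (fun z : E => h ‖z‖) (x • e)
        - iteratedFDeriv ℝ j (fun z : E => h ‖z‖) (y • e)‖ := by
  rw [iteratedDeriv_eq_iteratedFDeriv_comp_norm heven he hj hu,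
    iteratedDeriv_eq_iteratedFDeriv_comp_norm heven he hj hu]
  simpa [he] using (iteratedFDeriv ℝ j (fun z : E => h ‖z‖) (x • e)
    - iteratedFDeriv ℝ j (fun z : E => h ‖z‖) (y • e)).le_opNorm fun _ => e

end UnitVector

end InnerProductSpace

lemma div_rpow_norm_sub_le {X : Type*} [NormedAddCommGroup X] {z w : X} {a K α : ℝ} (hzw : z ≠ w)
    (h : a ≤ K * ‖z - w‖ ^ α) : a / ‖z - w‖ ^ α ≤ K :=
  (div_le_iff₀ (Real.rpow_pos_of_pos (norm_sub_pos_iff.2 hzw) α)).2 h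

lemma norm_smul_sub_smul_of_norm_eq_one {X : Type*} [NormedAddCommGroup X] [NormedSpace ℝ X]
    {e : X} (he : ‖e‖ = 1) (x y : ℝ) : ‖x • e - y • e‖ = |x - y| := by
  rw [← sub_smul, norm_smul, he, mul_one, Real.norm_eq_abs]

lemma abs_le_supOn_univ {f : ℝ → ℝ} {M : ℝ} (hM : ∀ x, |f x| ≤ M) (x : ℝ) :
    |f x| ≤ supOn f univ :=
  le_csSup ⟨M, by rintro _ ⟨y, -, rfl⟩; exact hM y⟩ ⟨x, mem_univ x, rfl⟩

lemma abs_sub_le_hSemiOn_univ {f : ℝ → ℝ} {C α : ℝ} (hα : α ≠ 0)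
    (hC : ∀ x y, |f x - f y| ≤ C * |x - y| ^ α) (x y : ℝ) :
    |f x - f y| ≤ hSemiOn α f univ * |x - y| ^ α := by
  rcases eq_or_ne x y with rfl | hxy
  · simp [Real.zero_rpow hα]
  rw [← div_le_iff₀ (Real.rpow_pos_of_pos (abs_sub_pos.2 hxy) α)]
  exact le_csSup ⟨C, by rintro _ ⟨x, -, y, -, hxy, rfl⟩; exact div_rpow_norm_sub_le hxy (hC x y)⟩
    ⟨x, mem_univ x, y, mem_univ y, hxy, rfl⟩

lemma deriv_zero_of_even {h : ℝ → ℝ} (heven : ∀ x, h (-x) = h x) : deriv h 0 = 0 := by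
  have := deriv_comp_neg h 0
  simp only [heven, neg_zero] at this
  linarith

/-- The supremum of the Hölder quotients of a map between normed groups. -/
noncomputable def holderSeminorm {X F : Type*} [NormedAddCommGroup X] [NormedAddCommGroup F]
    (α : ℝ) (A : X → F) : ℝ :=
  sSup {r : ℝ | ∃ z w : X, z ≠ w ∧ r = ‖A z - A w‖ / ‖z - w‖ ^ α}

section HolderSeminorm

variable {X F : Type*} [NormedAddCommGroup X] [NormedAddCommGroup F]
  {A : X → F} {α K : ℝ}

lemma holderSeminorm_le (hA : ∀ z w, ‖A z - A w‖ ≤ K * ‖z - w‖ ^ α) (hK : 0 ≤ K) :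
    holderSeminorm α A ≤ K :=
  Real.sSup_le (by rintro _ ⟨z, w, hzw, rfl⟩; exact div_rpow_norm_sub_le hzw (hA z w)) hK

lemma hSemiOn_univ_le_holderSeminorm [NormedSpace ℝ X] {f : ℝ → ℝ} {e : X} (he : ‖e‖ = 1)
    (hA : ∀ z w, ‖A z - A w‖ ≤ K * ‖z - w‖ ^ α)
    (hf : ∀ x y : ℝ, |f x - f y| ≤ ‖A (x • e) - A (y • e)‖) :
    hSemiOn α f univ ≤ holderSeminorm α A := by
  refine Real.sSup_le ?_ (Real.sSup_nonneg (by rintro _ ⟨x, y, -, rfl⟩; positivity))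
  rintro _ ⟨x, -, y, -, hxy, rfl⟩
  have hne : x • e ≠ y • e := by
    rwa [← norm_sub_pos_iff, norm_smul_sub_smul_of_norm_eq_one he, abs_sub_pos]
  have hle : ‖A (x • e) - A (y • e)‖ / ‖x • e - y • e‖ ^ α ≤ holderSeminorm α A :=
    le_csSup ⟨K, by rintro _ ⟨z, w, hzw, rfl⟩; exact div_rpow_norm_sub_le hzw (hA z w)⟩
      ⟨_, _, hne, rfl⟩
  rw [norm_smul_sub_smul_of_norm_eq_one he] at hle
  refine le_trans ?_ hle
  gcongr
  exact hf x y

end HolderSeminorm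

lemma supOn_univ_le_sSup_range {X : Type*} {f : ℝ → ℝ} {a : X → ℝ} {M : ℝ} (ha : ∀ z, a z ≤ M)
    (p : ℝ → X) (hf : ∀ x, |f x| ≤ a (p x)) :
    supOn f univ ≤ sSup (Set.range a) := by
  have hle : ∀ z, a z ≤ sSup (Set.range a) := fun z =>
    le_csSup ⟨M, by rintro _ ⟨w, rfl⟩; exact ha w⟩ ⟨z, rfl⟩
  refine Real.sSup_le ?_ (((abs_nonneg _).trans (hf 0)).trans (hle _))
  rintro _ ⟨x, -, rfl⟩
  exact (hf x).trans (hle _)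

lemma sSup_range_le {X : Type*} {a : X → ℝ} {K : ℝ} (ha : ∀ z, a z ≤ K) (hK : 0 ≤ K) :
    sSup (Set.range a) ≤ K :=
  Real.sSup_le (by rintro _ ⟨z, rfl⟩; exact ha z) hK

lemma hNormOn_zero_eq_c0NormE {α : ℝ} (hα : 0 < α) {h : ℝ → ℝ} (heven : ∀ x, h (-x) = h x)
    {M C : ℝ} (hM : ∀ x, |h x| ≤ M) (hC : ∀ x y, |h x - h y| ≤ C * |x - y| ^ α) :
    hNormOn 0 α h univ = c0NormE α fun z => h ‖z‖ := by
  have he : ‖(EuclideanSpace.single 0 1 : EuclideanSpace ℝ (Fin 2))‖ = 1 := by simp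
  have hline := even_comp_norm_smul heven he
  have hH := hSemiOn_nonneg α h univ
  have hsemi : ∀ z w : EuclideanSpace ℝ (Fin 2),
      ‖h ‖z‖ - h ‖w‖‖ ≤ hSemiOn α h univ * ‖z - w‖ ^ α := fun z w => by
    refine (abs_sub_le_hSemiOn_univ hα.ne' hC _ _).trans ?_
    gcongr
    exact abs_norm_sub_norm_le z w
  have hsup : supOn h univ = sSup (Set.range fun z : EuclideanSpace ℝ (Fin 2) => |h ‖z‖|) :=
    le_antisymm
      (supOn_univ_le_sSup_range (fun z => hM ‖z‖) _ fun x => (congrArg abs (hline x)).ge)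
      (sSup_range_le (fun z => abs_le_supOn_univ hM ‖z‖) (supOn_nonneg h univ))
  have hsemi_eq : hSemiOn α h univ
      = holderSeminorm α fun z : EuclideanSpace ℝ (Fin 2) => h ‖z‖ :=
    le_antisymm
      (hSemiOn_univ_le_holderSeminorm he hsemi fun x y => by
        rw [hline, hline, Real.norm_eq_abs])
      (holderSeminorm_le hsemi hH)
  simp only [hNormOn, zero_add, Finset.sum_range_one, iteratedDeriv_zero]
  rw [hsup, hsemi_eq]
  rfl

set_option maxSynthPendingDepth 3 in
lemma c2NormE_comp_norm_bounds {α : ℝ} (hα : 0 < α) (hα1 : α ≤ 1) {h : ℝ → ℝ}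
    (heven : ∀ x, h (-x) = h x) (hsm : ContDiff ℝ 2 h) {M C : ℝ}
    (hM : ∀ j ∈ Finset.range 3, ∀ x, |iteratedDeriv j h x| ≤ M)
    (hC : ∀ x y, |iteratedDeriv 2 h x - iteratedDeriv 2 h y| ≤ C * |x - y| ^ α) :
    ContDiff ℝ 2 (fun z : EuclideanSpace ℝ (Fin 2) => h ‖z‖) ∧
      hNormOn 2 α h univ ≤ c2NormE α (fun z => h ‖z‖) ∧
      c2NormE α (fun z => h ‖z‖) ≤ 11 * hNormOn 2 α h univ := by
  have he : ‖(EuclideanSpace.single 0 1 : EuclideanSpace ℝ (Fin 2))‖ = 1 := by simp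
  have hS : ∀ j ∈ Finset.range 3, ∀ x, |iteratedDeriv j h x| ≤ supOn (iteratedDeriv j h) univ :=
    fun j hj => abs_le_supOn_univ (hM j hj)
  have hHol := abs_sub_le_hSemiOn_univ hα.ne' hC
  have hH0 := hSemiOn_nonneg α (iteratedDeriv 2 h) univ
  have hS0 := fun j => supOn_nonneg (iteratedDeriv j h) univ
  have hh : ∀ x, HasDerivAt h (iteratedDeriv 1 h x) x := fun x => by
    rw [iteratedDeriv_one]
    exact (hsm.differentiable two_ne_zero x).hasDerivAt
  have hf : ∀ x, HasDerivAt (iteratedDeriv 1 h) (iteratedDeriv 2 h x) x := fun x => by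
    rw [iteratedDeriv_succ (n := 1)]
    exact (hsm.differentiable_iteratedDeriv 1 (by norm_num) x).hasDerivAt
  have hg : Continuous (iteratedDeriv 2 h) := hsm.continuous_iteratedDeriv 2 le_rfl
  have h0 : iteratedDeriv 1 h 0 = 0 := by rw [iteratedDeriv_one, deriv_zero_of_even heven]
  have hc : Continuous (originAverage (iteratedDeriv 2 h)) :=
    continuous_of_norm_sub_le_rpow hα (abs_originAverage_sub_le hg hα.le hHol)
  have hHess := norm_radialHessian_sub_le (E := EuclideanSpace ℝ (Fin 2)) hg hα hα1 hHol
  have hu : ContDiff ℝ 2 fun z : EuclideanSpace ℝ (Fin 2) => h ‖z‖ :=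
    contDiff_two_comp_norm hh hf hg h0 hc (continuous_of_norm_sub_le_rpow hα hHess)
  have b0 : ∀ z, ‖iteratedFDeriv ℝ 0 (fun z : EuclideanSpace ℝ (Fin 2) => h ‖z‖) z‖
      ≤ supOn (iteratedDeriv 0 h) univ := fun z => by
    rw [norm_iteratedFDeriv_zero]
    simpa using hS 0 (by simp) ‖z‖
  have b1 : ∀ z, ‖iteratedFDeriv ℝ 1 (fun z : EuclideanSpace ℝ (Fin 2) => h ‖z‖) z‖
      ≤ supOn (iteratedDeriv 1 h) univ := fun z => by
    rw [norm_iteratedFDeriv_one_comp_norm hh hf hg h0]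
    exact hS 1 (by simp) ‖z‖
  have b2 : ∀ z, ‖iteratedFDeriv ℝ 2 (fun z : EuclideanSpace ℝ (Fin 2) => h ‖z‖) z‖
      ≤ 3 * supOn (iteratedDeriv 2 h) univ := fun z =>
    (norm_iteratedFDeriv_two_comp_norm_le hh hf hg h0 hc z).trans
      (norm_radialHessian_le (hS 2 (by simp)) z)
  have bH : ∀ z w, ‖iteratedFDeriv ℝ 2 (fun z : EuclideanSpace ℝ (Fin 2) => h ‖z‖) z
      - iteratedFDeriv ℝ 2 (fun z : EuclideanSpace ℝ (Fin 2) => h ‖z‖) w‖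
      ≤ 11 * hSemiOn α (iteratedDeriv 2 h) univ * ‖z - w‖ ^ α := fun z w =>
    (norm_iteratedFDeriv_two_comp_norm_sub_le hh hf hg h0 hc z w).trans (hHess z w)
  have hc2 : c2NormE α (fun z => h ‖z‖)
      = (∑ j ∈ Finset.range 3, sSup (Set.range fun z =>
          ‖iteratedFDeriv ℝ j (fun z : EuclideanSpace ℝ (Fin 2) => h ‖z‖) z‖))
        + holderSeminorm α
          (iteratedFDeriv ℝ 2 (fun z : EuclideanSpace ℝ (Fin 2) => h ‖z‖)) := rfl
  simp only [hc2, hNormOn, Finset.sum_range_succ, Finset.sum_range_zero, zero_add]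
  refine ⟨hu, ?_, ?_⟩
  · gcongr
    · exact supOn_univ_le_sSup_range b0 _
        (abs_iteratedDeriv_le_norm_iteratedFDeriv heven he (Nat.zero_le 2) hu)
    · exact supOn_univ_le_sSup_range b1 _
        (abs_iteratedDeriv_le_norm_iteratedFDeriv heven he one_le_two hu)
    · exact supOn_univ_le_sSup_range b2 _
        (abs_iteratedDeriv_le_norm_iteratedFDeriv heven he le_rfl hu)
    · exact hSemiOn_univ_le_holderSeminorm he bH
        (abs_iteratedDeriv_sub_le_norm_iteratedFDeriv_sub heven he le_rfl hu)
  · linarith [sSup_range_le b0 (hS0 0), sSup_range_le b1 (hS0 1),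
      sSup_range_le b2 (mul_nonneg zero_le_three (hS0 2)),
      holderSeminorm_le bH (mul_nonneg (by norm_num) hH0), hS0 0, hS0 1, hS0 2]

/-- For an even function `h : ℝ → ℝ` and the radial function `u(z) = h(|z|)` on ℝ²:
`‖h‖_{C^α(ℝ)} = ‖u‖_{C^α(ℝ²)}`, and if `h ∈ C^{2+α}` then `u ∈ C^{2+α}(ℝ²)` with
`‖h‖_{C^{2+α}(ℝ)} ≤ ‖u‖_{C^{2+α}(ℝ²)} ≤ C‖h‖_{C^{2+α}(ℝ)}`, `C ≥ 1` independent of `h`. -/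
theorem stmt11 (α : ℝ) (hα : α ∈ Ioo (0:ℝ) 1) :
    (∀ h : ℝ → ℝ, (∀ x, h (-x) = h x) →
      (∃ M : ℝ, ∀ x, |h x| ≤ M) →
      (∃ C : ℝ, ∀ x y, |h x - h y| ≤ C * |x - y| ^ α) →
      hNormOn 0 α h univ = c0NormE α (fun z => h ‖z‖)) ∧
    ∃ C ≥ (1:ℝ), ∀ h : ℝ → ℝ, (∀ x, h (-x) = h x) →
      ContDiff ℝ 2 h →
      (∃ M : ℝ, ∀ j ∈ Finset.range 3, ∀ x, |iteratedDeriv j h x| ≤ M) →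
      (∃ C2 : ℝ, ∀ x y, |iteratedDeriv 2 h x - iteratedDeriv 2 h y| ≤ C2 * |x - y| ^ α) →
      ContDiff ℝ 2 (fun z : EuclideanSpace ℝ (Fin 2) => h ‖z‖) ∧
      hNormOn 2 α h univ ≤ c2NormE α (fun z => h ‖z‖) ∧
      c2NormE α (fun z => h ‖z‖) ≤ C * hNormOn 2 α h univ := by
  refine ⟨fun h heven ⟨M, hM⟩ ⟨C, hC⟩ => hNormOn_zero_eq_c0NormE hα.1 heven hM hC,
    11, by norm_num, fun h heven hsm ⟨M, hM⟩ ⟨C, hC⟩ =>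
      c2NormE_comp_norm_bounds hα.1 hα.2.le heven hsm hM hC⟩
end
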